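/- Dangerous disjuncts require cut: for every formula A, degree d and height α, if T A d α and A is a dangerous disjunct (i.e. A is a disjunction each of whose disjuncts is the atomic formula 0 = S 0), then 0 < d. -/

import Mathlib

/-- Terms of the language of arithmetic. -/
inductive PATerm : Type
  | zero : PATerm
  | var : ℕ → PATerm
  | succ : PATerm → PATerm
  | plus : PATerm → PATerm → PATerm
  | times : PATerm → PATerm → PATerm
  deriving DecidableEq

namespace PATerm

/-- The list of variables occurring in a term. -/
def varList : PATerm → List ℕ
  | zero => []
  | var n => [n]
  | succ t => t.varList
  | plus t s => t.varList ++ s.varList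
  | times t s => t.varList ++ s.varList

/-- A term is closed if it has no variables. -/
def IsClosed (t : PATerm) : Prop := t.varList = []

/-- Evaluation of a term to a natural number (variables get the junk value 0;
this is only meaningful for closed terms). -/
def eval : PATerm → ℕ
  | zero => 0
  | var _ => 0
  | succ t => t.eval + 1
  | plus t s => t.eval + s.eval
  | times t s => t.eval * s.eval

/-- Substitution of the term `r` for the variable `x_n` in a term. -/
def subst (n : ℕ) (r : PATerm) : PATerm → PATerm
  | zero => zero
  | var m => if m = n then r else var m
  | succ t => succ (subst n r t)
  | plus t s => plus (subst n r t) (subst n r s)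
  | times t s => times (subst n r t) (subst n r s)

end PATerm

/-- Formulas of the language of arithmetic. -/
inductive PAFormula : Type
  | eq : PATerm → PATerm → PAFormula
  | neg : PAFormula → PAFormula
  | lor : PAFormula → PAFormula → PAFormula
  | univ : ℕ → PAFormula → PAFormula
  deriving DecidableEq

namespace PAFormula

/-- The list of free variables of a formula. -/
def freeList : PAFormula → List ℕ
  | eq t s => t.varList ++ s.varList
  | neg A => A.freeList
  | lor A B => A.freeList ++ B.freeList
  | univ n A => A.freeList.filter (fun m => m ≠ n)

/-- A formula is closed if it has no free variables. -/
def IsClosed (A : PAFormula) : Prop := A.freeList = []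

/-- Substitution of the term `r` for all free occurrences of `x_n` in a formula. -/
def subst (n : ℕ) (r : PATerm) : PAFormula → PAFormula
  | eq t s => eq (t.subst n r) (s.subst n r)
  | neg A => neg (subst n r A)
  | lor A B => lor (subst n r A) (subst n r B)
  | univ m A => if m = n then univ m A else univ m (subst n r A)

/-- Number of logical connectives (¬, ∨, ∀) of a formula. -/
def numConn : PAFormula → ℕ
  | eq _ _ => 0
  | neg A => A.numConn + 1
  | lor A B => A.numConn + B.numConn + 1
  | univ _ A => A.numConn + 1

/-- A correct atomic formula: a closed equation whose sides evaluate to the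
same natural number. -/
def Correct : PAFormula → Prop
  | eq t s => t.IsClosed ∧ s.IsClosed ∧ t.eval = s.eval
  | _ => False

/-- An incorrect atomic formula: a closed equation whose sides evaluate to
different natural numbers. -/
def Incorrect : PAFormula → Prop
  | eq t s => t.IsClosed ∧ s.IsClosed ∧ t.eval ≠ s.eval
  | _ => False

end PAFormula

/-- Successor on ordinal notations. -/
def osucc (a : ONote) : ONote := a + 1

/-- Maximum of two ordinal notations (with respect to the order on the denoted
ordinals). -/
def omax (a b : ONote) : ONote := if a.cmp b = Ordering.lt then b else a

/-- The derivability predicate of the infinitary sequent calculus PA_ω: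
`PAW A d α` means the (closed) formula `A` is derivable with cut degree `d`
and height `α`. -/
inductive PAW : PAFormula → ℕ → ONote → Prop
  | axCorrect (A : PAFormula) :
      A.Correct → PAW A 0 0
  | axIncorrect (A : PAFormula) :
      A.Incorrect → PAW A.neg 0 0
  | exchAB (A B : PAFormula) (d : ℕ) (α : ONote) :
      PAW (A.lor B) d α → PAW (B.lor A) d α
  | exchCAB (C A B : PAFormula) (d : ℕ) (α : ONote) :
      PAW ((C.lor A).lor B) d α → PAW ((C.lor B).lor A) d α
  | exchABD (A B D : PAFormula) (d : ℕ) (α : ONote) :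
      PAW ((A.lor B).lor D) d α → PAW ((B.lor A).lor D) d α
  | exchCABD (C A B D : PAFormula) (d : ℕ) (α : ONote) :
      PAW (((C.lor A).lor B).lor D) d α → PAW (((C.lor B).lor A).lor D) d α
  | conA (A : PAFormula) (d : ℕ) (α : ONote) :
      PAW (A.lor A) d α → PAW A d α
  | conAD (A D : PAFormula) (d : ℕ) (α : ONote) :
      PAW ((A.lor A).lor D) d α → PAW (A.lor D) d α
  | weak (A D : PAFormula) (d : ℕ) (α : ONote) :
      A.IsClosed → PAW D d α → PAW (A.lor D) d (osucc α)
  | negA (A : PAFormula) (d : ℕ) (α : ONote) :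
      PAW A d α → PAW A.neg.neg d (osucc α)
  | negAD (A D : PAFormula) (d : ℕ) (α : ONote) :
      PAW (A.lor D) d α → PAW (A.neg.neg.lor D) d (osucc α)
  | quantA (A : PAFormula) (n : ℕ) (t : PATerm) (d : ℕ) (α : ONote) :
      t.IsClosed → PAW (A.subst n t).neg d α →
      PAW (PAFormula.univ n A).neg d (osucc α)
  | quantAD (A D : PAFormula) (n : ℕ) (t : PATerm) (d : ℕ) (α : ONote) :
      t.IsClosed → PAW ((A.subst n t).neg.lor D) d α →
      PAW ((PAFormula.univ n A).neg.lor D) d (osucc α)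
  | demA (A B : PAFormula) (d₁ d₂ : ℕ) (α₁ α₂ : ONote) :
      PAW A.neg d₁ α₁ → PAW B.neg d₂ α₂ →
      PAW (A.lor B).neg (max d₁ d₂) (osucc (omax α₁ α₂))
  | demAD (A B D : PAFormula) (d₁ d₂ : ℕ) (α₁ α₂ : ONote) :
      PAW (A.neg.lor D) d₁ α₁ → PAW (B.neg.lor D) d₂ α₂ →
      PAW ((A.lor B).neg.lor D) (max d₁ d₂) (osucc (omax α₁ α₂))
  | omegaA (A : PAFormula) (n : ℕ) (d : ℕ) (α : ONote) :
      (∀ t : PATerm, t.IsClosed → PAW (A.subst n t) d α) →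
      PAW (PAFormula.univ n A) d (osucc α)
  | omegaAD (A D : PAFormula) (n : ℕ) (d : ℕ) (α : ONote) :
      (∀ t : PATerm, t.IsClosed → PAW ((A.subst n t).lor D) d α) →
      PAW ((PAFormula.univ n A).lor D) d (osucc α)
  | cutCA (C A : PAFormula) (d₁ d₂ : ℕ) (α₁ α₂ : ONote) :
      PAW (C.lor A) d₁ α₁ → PAW A.neg d₂ α₂ →
      PAW C (max (max d₁ d₂) A.neg.numConn) (osucc (omax α₁ α₂))
  | cutAD (A D : PAFormula) (d₁ d₂ : ℕ) (α₁ α₂ : ONote) :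
      PAW A d₁ α₁ → PAW (A.neg.lor D) d₂ α₂ →
      PAW D (max (max d₁ d₂) A.neg.numConn) (osucc (osucc (omax α₁ α₂)))
  | cutCAD (C A D : PAFormula) (d₁ d₂ : ℕ) (α₁ α₂ : ONote) :
      PAW (C.lor A) d₁ α₁ → PAW (A.neg.lor D) d₂ α₂ →
      PAW (C.lor D) (max (max d₁ d₂) A.neg.numConn) (osucc (omax α₁ α₂))

/-- A dangerous disjunct: a disjunction each of whose disjuncts is the atomic
formula `0 = S 0`. -/
inductive DangerousDisjunct : PAFormula → Prop
  | base : DangerousDisjunct (PAFormula.eq PATerm.zero (PATerm.succ PATerm.zero))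
  | lor {A B : PAFormula} :
      DangerousDisjunct A → DangerousDisjunct B → DangerousDisjunct (A.lor B)

namespace DangerousDisjunct

theorem lor_iff {A B : PAFormula} :
    DangerousDisjunct (A.lor B) ↔ DangerousDisjunct A ∧ DangerousDisjunct B :=
  ⟨fun | .lor hA hB => ⟨hA, hB⟩, fun h => .lor h.1 h.2⟩

theorem not_neg (A : PAFormula) : ¬ DangerousDisjunct A.neg := nofun

theorem not_univ (n : ℕ) (A : PAFormula) : ¬ DangerousDisjunct (PAFormula.univ n A) := nofun

theorem not_correct {A : PAFormula} (hA : DangerousDisjunct A) : ¬ A.Correct := by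
  cases hA <;> simp [PAFormula.Correct, PATerm.eval]

end DangerousDisjunct

/-- Dangerous disjuncts require cut: if `T A d α` and `A` is a dangerous
disjunct, then `0 < d`. -/
theorem paw_dangerous_not_deg_zero (A : PAFormula) (d : ℕ) (α : ONote)
    (h : PAW A d α) (hA : DangerousDisjunct A) : 0 < d := by
  induction h with
  | axCorrect A hc => exact absurd hc hA.not_correct
  | cutCA | cutAD | cutCAD =>
    exact lt_max_of_lt_right (Nat.succ_pos _)
  | _ =>
    simp_all [DangerousDisjunct.lor_iff, DangerousDisjunct.not_neg, DangerousDisjunct.not_univ]
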